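/- Let n ≥ 3 be an integer, ε > 0 and a ∈ ℝ^{n-1}. Then the Dirichlet energy of the standard bubble over the half-space is ∫_{{y ∈ ℝ^n : y_n > 0}} |∇U_{ε,a}(y)|² dy = K_n^{-2(n-1)} = ((n-2)/2)^{n-1} σ_{n-1}; in particular it is finite and independent of ε and a. -/

import Mathlib

open MeasureTheory Real

/-- The last coordinate `y_n` of a point `y ∈ ℝ^n`. -/
noncomputable def lastCoord (n : ℕ) (y : EuclideanSpace ℝ (Fin n)) : ℝ :=
  if h : 0 < n then y ⟨n - 1, Nat.sub_lt h one_pos⟩ else 0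

/-- The embedding `ℝ^{n-1} × ℝ → ℝ^n`, `(x, t) ↦ (x, t)`. -/
noncomputable def emb (n : ℕ) (x : EuclideanSpace ℝ (Fin (n - 1))) (t : ℝ) :
    EuclideanSpace ℝ (Fin n) :=
  (EuclideanSpace.equiv (Fin n) ℝ).symm
    (fun i => if h : (i : ℕ) < n - 1 then x ⟨i, h⟩ else t)

/-- The area `σ_{n-1}` of the unit `(n-1)`-sphere in `ℝ^n`. -/
noncomputable def sphereArea (n : ℕ) : ℝ :=
  n * (volume (Metric.ball (0 : EuclideanSpace ℝ (Fin n)) 1)).toReal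

/-- The sharp Sobolev trace constant `K_n`. -/
noncomputable def Kconst (n : ℕ) : ℝ :=
  (((n : ℝ) - 2) / 2) ^ (-(1 : ℝ) / 2) * sphereArea n ^ (-(1 : ℝ) / (2 * ((n : ℝ) - 1)))

/-- The standard bubble `U_{ε,a}`. -/
noncomputable def bubble (n : ℕ) (ε : ℝ) (a : EuclideanSpace ℝ (Fin (n - 1)))
    (y : EuclideanSpace ℝ (Fin n)) : ℝ :=
  (ε / ((lastCoord n y + ε / ((n : ℝ) - 2)) ^ 2 +
      ∑ i : Fin (n - 1), (y (Fin.castLE (Nat.sub_le n 1) i) - a i) ^ 2)) ^ (((n : ℝ) - 2) / 2)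

/-- The Euclidean Laplacian `Δu(y) = ∑ ∂²u/∂y_i²(y)`. -/
noncomputable def lap (n : ℕ) (u : EuclideanSpace ℝ (Fin n) → ℝ)
    (y : EuclideanSpace ℝ (Fin n)) : ℝ :=
  ∑ i : Fin n, iteratedDeriv 2 (fun t : ℝ => u (y + t • EuclideanSpace.single i (1 : ℝ))) 0


/-- The Gamma integral, as a lower Lebesgue integral. -/
lemma lintegral_rpow_mul_exp_neg_mul_Ioi {p r : ℝ} (hp : 0 < p) (hr : 0 < r) :
    ∫⁻ t in Set.Ioi (0 : ℝ), ENNReal.ofReal (t ^ (p - 1) * rexp (-(r * t))) =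
      ENNReal.ofReal ((1 / r) ^ p * Gamma p) := by
  have h := integral_rpow_mul_exp_neg_mul_Ioi hp hr
  have hpos : 0 < (1 / r) ^ p * Gamma p :=
    mul_pos (rpow_pos_of_pos (by positivity) _) (Gamma_pos_of_pos hp)
  rw [← h, ofReal_integral_eq_lintegral_ofReal]
  · exact Integrable.of_integral_ne_zero (by rw [h]; exact hpos.ne')
  · filter_upwards [ae_restrict_mem measurableSet_Ioi] with t ht
    have : (0 : ℝ) < t := ht
    positivity

/-- The Gaussian integral on `ℝ^m`, as a lower Lebesgue integral. -/
lemma lintegral_exp_neg_mul_norm_sq (m : ℕ) {t : ℝ} (ht : 0 < t) :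
    ∫⁻ x : EuclideanSpace ℝ (Fin m), ENNReal.ofReal (rexp (-t * ‖x‖ ^ 2)) =
      ENNReal.ofReal ((π / t) ^ ((m : ℝ) / 2)) := by
  have h := GaussianFourier.integral_rexp_neg_mul_sq_norm (V := EuclideanSpace ℝ (Fin m)) ht
  rw [finrank_euclideanSpace_fin] at h
  have hpos : 0 < (π / t) ^ ((m : ℝ) / 2) := by positivity
  rw [← h, ofReal_integral_eq_lintegral_ofReal]
  · exact Integrable.of_integral_ne_zero (by rw [h]; exact hpos.ne')
  · exact ae_of_all _ fun x => (exp_pos _).le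

lemma lintegral_inv_sq_add_norm_sq_pow {m : ℕ} (hm : 0 < m) {s : ℝ} (hs : 0 < s) :
    ∫⁻ x : EuclideanSpace ℝ (Fin m), ENNReal.ofReal (((s ^ 2 + ‖x‖ ^ 2) ^ m)⁻¹) =
      ENNReal.ofReal (π ^ ((m : ℝ) / 2) * Gamma ((m : ℝ) / 2) / Gamma m * s ^ (-(m : ℝ))) := by
  have hm' : (0 : ℝ) < m := by exact_mod_cast hm
  have hG : 0 < Gamma (m : ℝ) := Gamma_pos_of_pos hm'
  have key : ∫⁻ x : EuclideanSpace ℝ (Fin m), ∫⁻ t in Set.Ioi (0 : ℝ),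
        ENNReal.ofReal (t ^ ((m : ℝ) - 1) * rexp (-((s ^ 2 + ‖x‖ ^ 2) * t))) =
      ENNReal.ofReal (π ^ ((m : ℝ) / 2) * Gamma ((m : ℝ) / 2) * s ^ (-(m : ℝ))) := by
    rw [lintegral_lintegral_swap
      (by apply Measurable.aemeasurable; unfold Function.uncurry; fun_prop)]
    have inner : ∀ t ∈ Set.Ioi (0 : ℝ), ∫⁻ x : EuclideanSpace ℝ (Fin m),
        ENNReal.ofReal (t ^ ((m : ℝ) - 1) * rexp (-((s ^ 2 + ‖x‖ ^ 2) * t))) =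
        ENNReal.ofReal (π ^ ((m : ℝ) / 2)) *
          ENNReal.ofReal (t ^ ((m : ℝ) / 2 - 1) * rexp (-(s ^ 2 * t))) := by
      intro t ht
      have ht : 0 < t := ht
      have e : ∀ x : EuclideanSpace ℝ (Fin m),
          ENNReal.ofReal (t ^ ((m : ℝ) - 1) * rexp (-((s ^ 2 + ‖x‖ ^ 2) * t))) =
          ENNReal.ofReal (t ^ ((m : ℝ) - 1) * rexp (-(s ^ 2 * t))) *
            ENNReal.ofReal (rexp (-t * ‖x‖ ^ 2)) := by
        intro x
        rw [← ENNReal.ofReal_mul (by positivity), mul_assoc, ← exp_add]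
        ring_nf
      simp_rw [e]
      rw [lintegral_const_mul _ (by fun_prop), lintegral_exp_neg_mul_norm_sq m ht,
        ← ENNReal.ofReal_mul (by positivity), ← ENNReal.ofReal_mul (by positivity)]
      congr 1
      have : t ^ ((m : ℝ) - 1) = t ^ ((m : ℝ) / 2 - 1) * t ^ ((m : ℝ) / 2) := by
        rw [← rpow_add ht]; ring_nf
      rw [div_rpow pi_pos.le ht.le, this]
      field_simp
    rw [setLIntegral_congr_fun measurableSet_Ioi inner, lintegral_const_mul _ (by fun_prop),
      lintegral_rpow_mul_exp_neg_mul_Ioi (by positivity) (by positivity),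
      ← ENNReal.ofReal_mul (by positivity)]
    congr 1
    have : (1 / s ^ 2) ^ ((m : ℝ) / 2) = s ^ (-(m : ℝ)) := by
      rw [one_div, inv_rpow (by positivity), ← rpow_natCast, ← rpow_mul hs.le, ← rpow_neg hs.le]
      push_cast; ring_nf
    rw [this]; ring
  have e : ∀ x : EuclideanSpace ℝ (Fin m), ENNReal.ofReal (((s ^ 2 + ‖x‖ ^ 2) ^ m)⁻¹) =
      ENNReal.ofReal ((Gamma m)⁻¹) * ∫⁻ t in Set.Ioi (0 : ℝ),
        ENNReal.ofReal (t ^ ((m : ℝ) - 1) * rexp (-((s ^ 2 + ‖x‖ ^ 2) * t))) := by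
    intro x
    rw [lintegral_rpow_mul_exp_neg_mul_Ioi hm' (by positivity),
      ← ENNReal.ofReal_mul (by positivity), rpow_natCast, one_div, inv_pow]
    congr 1
    field_simp
  simp_rw [e]
  rw [lintegral_const_mul' _ _ ENNReal.ofReal_ne_top, key, ← ENNReal.ofReal_mul (by positivity)]
  congr 1
  ring

lemma lintegral_Ioi_add_rpow_neg {p c : ℝ} (hp : 1 < p) (hc : 0 < c) :
    ∫⁻ s in Set.Ioi (0 : ℝ), ENNReal.ofReal ((s + c) ^ (-p)) =
      ENNReal.ofReal (c ^ (1 - p) / (p - 1)) := by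
  have hpre : Set.Ioi (0 : ℝ) = (fun s => s + c) ⁻¹' Set.Ioi c := by
    ext s; simp
  rw [hpre, (measurePreserving_add_right volume c).setLIntegral_comp_preimage measurableSet_Ioi
    (f := fun s => ENNReal.ofReal (s ^ (-p))) (by fun_prop),
    ← ofReal_integral_eq_lintegral_ofReal (integrableOn_Ioi_rpow_of_lt (by linarith) hc),
    integral_Ioi_rpow_of_lt (by linarith) hc]
  · rw [show -p + 1 = -(p - 1) by ring, neg_div_neg_eq, neg_sub]
  · filter_upwards [ae_restrict_mem measurableSet_Ioi] with t ht
    exact rpow_nonneg (hc.trans ht).le _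

/-- Splitting off the last coordinate of `ℝ^{m+1}` preserves the volume. -/
lemma volume_preserving_last_castSucc (m : ℕ) :
    MeasurePreserving (fun y : EuclideanSpace ℝ (Fin (m + 1)) =>
      (y (Fin.last m), WithLp.toLp 2 fun i : Fin m => y i.castSucc)) := by
  have h1 := EuclideanSpace.volume_preserving_symm_measurableEquiv_toLp (Fin (m + 1))
  have h2 := volume_preserving_piFinSuccAbove (fun _ : Fin (m + 1) => ℝ) (Fin.last m)
  have h3 := (MeasurePreserving.id (volume : Measure ℝ)).prod (PiLp.volume_preserving_toLp (Fin m))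
  rw [← Measure.volume_eq_prod, ← Measure.volume_eq_prod] at h3
  have h := h3.comp (h2.comp h1)
  convert h using 1
  ext y
  · rfl
  · simp [MeasurableEquiv.piFinSuccAbove, Fin.insertNthEquiv, Fin.init]

lemma measurable_halfSpace_integrand {m : ℕ} (c : ℝ) (a : EuclideanSpace ℝ (Fin m)) :
    Measurable fun z : ℝ × EuclideanSpace ℝ (Fin m) =>
      (((z.1 + c) ^ 2 + ‖z.2 - a‖ ^ 2) ^ m)⁻¹ := by
  fun_prop

lemma lintegral_halfSpace {m : ℕ} (hm : 2 ≤ m) {c : ℝ} (hc : 0 < c)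
    (a : EuclideanSpace ℝ (Fin m)) :
    ∫⁻ y in {y : EuclideanSpace ℝ (Fin (m + 1)) | 0 < y (Fin.last m)},
        ENNReal.ofReal ((((y (Fin.last m) + c) ^ 2 +
          ‖WithLp.toLp 2 (fun i : Fin m => y i.castSucc) - a‖ ^ 2) ^ m)⁻¹) =
      ENNReal.ofReal (π ^ ((m : ℝ) / 2) * Gamma ((m : ℝ) / 2) / Gamma m *
        (c ^ (1 - (m : ℝ)) / (m - 1))) := by
  have hm' : (2 : ℝ) ≤ m := by exact_mod_cast hm
  have h := (volume_preserving_last_castSucc m).setLIntegral_comp_preimage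
    (measurableSet_Ioi (a := (0 : ℝ)).prod MeasurableSet.univ)
    (measurable_halfSpace_integrand c a).ennreal_ofReal
  have hset : {y : EuclideanSpace ℝ (Fin (m + 1)) | 0 < y (Fin.last m)} =
      (fun y : EuclideanSpace ℝ (Fin (m + 1)) =>
        (y (Fin.last m), WithLp.toLp 2 fun i : Fin m => y i.castSucc)) ⁻¹'
          (Set.Ioi 0 ×ˢ Set.univ) := by
    ext y; simp
  rw [hset]
  refine h.trans ?_
  rw [Measure.volume_eq_prod, ← Measure.prod_restrict, Measure.restrict_univ,
    lintegral_prod _ (measurable_halfSpace_integrand c a).ennreal_ofReal.aemeasurable]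
  have inner : ∀ s ∈ Set.Ioi (0 : ℝ), ∫⁻ x : EuclideanSpace ℝ (Fin m),
      ENNReal.ofReal ((((s + c) ^ 2 + ‖x - a‖ ^ 2) ^ m)⁻¹) =
      ENNReal.ofReal (π ^ ((m : ℝ) / 2) * Gamma ((m : ℝ) / 2) / Gamma m) *
        ENNReal.ofReal ((s + c) ^ (-(m : ℝ))) := by
    intro s hs
    rw [lintegral_sub_right_eq_self
      (fun x : EuclideanSpace ℝ (Fin m) => ENNReal.ofReal ((((s + c) ^ 2 + ‖x‖ ^ 2) ^ m)⁻¹)) a,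
      lintegral_inv_sq_add_norm_sq_pow (by omega) (add_pos hs hc), ENNReal.ofReal_mul]
    have := Gamma_pos_of_pos (show (0 : ℝ) < m by linarith)
    have := Gamma_pos_of_pos (show (0 : ℝ) < m / 2 by linarith)
    positivity
  rw [setLIntegral_congr_fun measurableSet_Ioi inner, lintegral_const_mul _ (by fun_prop),
    lintegral_Ioi_add_rpow_neg (by linarith) hc, ENNReal.ofReal_mul]
  have := Gamma_pos_of_pos (show (0 : ℝ) < m by linarith)
  have := Gamma_pos_of_pos (show (0 : ℝ) < m / 2 by linarith)
  positivity

/-- The gradient of a power of an inverse squared distance. -/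
lemma norm_gradient_div_norm_sub_sq_rpow {E : Type*} [NormedAddCommGroup E]
    [InnerProductSpace ℝ E] [CompleteSpace E] {ε : ℝ} (hε : 0 < ε) (p : ℝ) (z : E) {y : E}
    (hy : y ≠ z) :
    ‖gradient (fun y => (ε / ‖y - z‖ ^ 2) ^ p) y‖ ^ 2 =
      4 * p ^ 2 / ‖y - z‖ ^ 2 * (ε / ‖y - z‖ ^ 2) ^ (2 * p) := by
  have hr : 0 < ‖y - z‖ := norm_pos_iff.mpr (sub_ne_zero.mpr hy)
  set r := ‖y - z‖ with hrdef
  have h1 : HasFDerivAt (fun y : E => ‖y - z‖ ^ 2) (2 • innerSL ℝ (y - z)) y := by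
    simpa using! (hasStrictFDerivAt_norm_sq (y - z)).hasFDerivAt.comp y
      ((hasFDerivAt_id y).sub_const z)
  have h2 : HasDerivAt (fun q : ℝ => (ε / q) ^ p)
      (-(ε / (r ^ 2) ^ 2) * p * (ε / r ^ 2) ^ (p - 1)) (r ^ 2) := by
    have h3 : HasDerivAt (fun q : ℝ => ε / q) (-(ε / (r ^ 2) ^ 2)) (r ^ 2) := by
      simpa [div_eq_mul_inv] using (hasDerivAt_inv (by positivity : r ^ 2 ≠ 0)).const_mul ε
    exact h3.rpow_const (Or.inl (by positivity))
  have h4 := (h2.comp_hasFDerivAt y h1).fderiv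
  have h5 : ‖gradient (fun y => (ε / ‖y - z‖ ^ 2) ^ p) y‖ =
      ‖fderiv ℝ (fun y => (ε / ‖y - z‖ ^ 2) ^ p) y‖ := by
    rw [gradient, LinearIsometryEquiv.norm_map]
  have h6 : ‖(2 • innerSL ℝ (y - z) : E →L[ℝ] ℝ)‖ = 2 * r := by
    rw [← Nat.cast_smul_eq_nsmul ℝ, norm_smul, innerSL_apply_norm]
    simp [hrdef]
  have h7 : (ε / r ^ 2) ^ (2 * p) = ((ε / r ^ 2) ^ (p - 1)) ^ 2 * (ε / r ^ 2) ^ 2 := by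
    have hq : 0 < ε / r ^ 2 := by positivity
    generalize ε / r ^ 2 = q at hq
    rw [← rpow_natCast, ← rpow_natCast, ← rpow_mul hq.le, ← rpow_add hq]
    congr 1
    push_cast; ring
  rw [h5]
  erw [h4]
  rw [norm_smul, h6, mul_pow, norm_eq_abs, sq_abs, h7]
  field_simp
  ring

/-- The area of the unit sphere in terms of the Gamma function. -/
lemma sphereArea_succ (m : ℕ) :
    sphereArea (m + 1) = 2 * √π ^ (m + 1) / Gamma ((m : ℝ) / 2 + 1 / 2) := by
  have hpos : (0 : ℝ) < (m : ℝ) / 2 + 1 / 2 := by positivity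
  have hG := Gamma_pos_of_pos hpos
  have hG' : Gamma (((m + 1 : ℕ) : ℝ) / 2 + 1) =
      ((m : ℝ) / 2 + 1 / 2) * Gamma ((m : ℝ) / 2 + 1 / 2) := by
    rw [← Gamma_add_one hpos.ne']
    push_cast; ring_nf
  rw [sphereArea, EuclideanSpace.volume_ball, Fintype.card_fin, hG', ENNReal.ofReal_one, one_pow,
    one_mul, ENNReal.toReal_ofReal (by positivity)]
  push_cast
  field_simp

lemma halfSpace_energy_const {m : ℕ} (hm : 2 ≤ m) {ε : ℝ} (hε : 0 < ε) :
    ((m : ℝ) - 1) ^ 2 * ε ^ ((m : ℝ) - 1) *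
      (π ^ ((m : ℝ) / 2) * Gamma ((m : ℝ) / 2) / Gamma m *
        ((ε / ((m : ℝ) - 1)) ^ (1 - (m : ℝ)) / (m - 1))) =
      (((m : ℝ) - 1) / 2) ^ m * sphereArea (m + 1) := by
  have hm' : (2 : ℝ) ≤ m := by exact_mod_cast hm
  have hk : 0 < (m : ℝ) - 1 := by linarith
  have hG1 := Gamma_pos_of_pos (show (0 : ℝ) < m by linarith)
  have hG2 := Gamma_pos_of_pos (show (0 : ℝ) < m / 2 + 1 / 2 by linarith)
  have hdup := Gamma_mul_Gamma_add_half ((m : ℝ) / 2)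
  rw [mul_div_cancel₀ (m : ℝ) (two_ne_zero)] at hdup
  have h2 : (2 : ℝ) ^ (1 - (m : ℝ)) = 2 / 2 ^ m := by
    rw [rpow_sub two_pos, rpow_one, rpow_natCast]
  have hpi : π ^ ((m : ℝ) / 2) = √π ^ m := by
    rw [sqrt_eq_rpow, ← rpow_natCast, ← rpow_mul pi_pos.le]
    ring_nf
  have hGm : Gamma ((m : ℝ) / 2) =
      Gamma m * (2 / 2 ^ m) * √π / Gamma ((m : ℝ) / 2 + 1 / 2) := by
    rw [eq_div_iff hG2.ne', hdup, h2]
  have hc : (ε / ((m : ℝ) - 1)) ^ (1 - (m : ℝ)) =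
      ((m : ℝ) - 1) ^ m / (((m : ℝ) - 1) * ε ^ ((m : ℝ) - 1)) := by
    rw [← neg_sub (m : ℝ) 1, rpow_neg (by positivity), div_rpow hε.le hk.le, rpow_sub_one hk.ne',
      rpow_natCast]
    field_simp
  have hεp : 0 < ε ^ ((m : ℝ) - 1) := rpow_pos_of_pos hε _
  rw [sphereArea_succ, hpi, hGm, hc, div_pow]
  generalize Gamma ((m : ℝ) / 2 + 1 / 2) = G at *
  field_simp
  ring

lemma sphereArea_pos {n : ℕ} (hn : 0 < n) : 0 < sphereArea n := by
  unfold sphereArea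
  have h : 0 < (volume (Metric.ball (0 : EuclideanSpace ℝ (Fin n)) 1)).toReal :=
    ENNReal.toReal_pos (Metric.measure_ball_pos _ _ one_pos).ne' measure_ball_lt_top.ne
  positivity

lemma Kconst_rpow {n : ℕ} (hn : 3 ≤ n) :
    Kconst n ^ (-(2 : ℝ) * ((n : ℝ) - 1)) = (((n : ℝ) - 2) / 2) ^ (n - 1) * sphereArea n := by
  have hn' : (3 : ℝ) ≤ n := by exact_mod_cast hn
  have hb : 0 < ((n : ℝ) - 2) / 2 := by linarith
  have hS := sphereArea_pos (show 0 < n by omega)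
  have h1 : (n : ℝ) - 1 ≠ 0 := by linarith
  unfold Kconst
  rw [mul_rpow (by positivity) (by positivity), ← rpow_mul hb.le, ← rpow_mul hS.le]
  congr 1
  · rw [← rpow_natCast, Nat.cast_sub (by omega)]
    congr 1
    push_cast; ring
  · rw [show -(1 : ℝ) / (2 * ((n : ℝ) - 1)) * (-2 * ((n : ℝ) - 1)) = 1 by field_simp, rpow_one]


lemma lastCoord_succ (m : ℕ) (y : EuclideanSpace ℝ (Fin (m + 1))) :
    lastCoord (m + 1) y = y (Fin.last m) := by
  simp [lastCoord, Fin.last]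

/-- The squared norm of the gradient of the bubble on the open half-space. -/
lemma norm_gradient_bubble_sq {m : ℕ} (hm : 2 ≤ m) {ε : ℝ} (hε : 0 < ε)
    (a : EuclideanSpace ℝ (Fin m)) {y : EuclideanSpace ℝ (Fin (m + 1))}
    (hy : 0 < y (Fin.last m)) :
    ‖gradient (bubble (m + 1) ε a) y‖ ^ 2 =
      ((m : ℝ) - 1) ^ 2 * ε ^ ((m : ℝ) - 1) * (((y (Fin.last m) + ε / ((m : ℝ) - 1)) ^ 2 +
        ‖WithLp.toLp 2 (fun i : Fin m => y i.castSucc) - a‖ ^ 2) ^ m)⁻¹ := by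
  have hm' : (2 : ℝ) ≤ m := by exact_mod_cast hm
  have hk : 0 < (m : ℝ) - 1 := by linarith
  set c := ε / ((m : ℝ) - 1) with hc
  have hcpos : 0 < c := by positivity
  let z : EuclideanSpace ℝ (Fin (m + 1)) := WithLp.toLp 2 (Fin.snoc (α := fun _ => ℝ) a (-c))
  have hz (x : EuclideanSpace ℝ (Fin (m + 1))) : ‖x - z‖ ^ 2 =
      (x (Fin.last m) + c) ^ 2 + ∑ i : Fin m, (x i.castSucc - a i) ^ 2 := by
    rw [EuclideanSpace.real_norm_sq_eq, Fin.sum_univ_castSucc, add_comm]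
    simp [z]
  have hb : bubble (m + 1) ε a = fun x => (ε / ‖x - z‖ ^ 2) ^ (((m : ℝ) - 1) / 2) := by
    funext x
    rw [hz, bubble, lastCoord_succ, hc]
    push_cast
    rw [show (m : ℝ) + 1 - 2 = m - 1 by ring]
    rfl
  have hyz : y ≠ z := by
    rintro rfl
    simp [z] at hy
    linarith
  have hr : 0 < ‖y - z‖ ^ 2 := by
    have := norm_pos_iff.mpr (sub_ne_zero.mpr hyz)
    positivity
  have hQ : (y (Fin.last m) + c) ^ 2 +
      ‖WithLp.toLp 2 (fun i : Fin m => y i.castSucc) - a‖ ^ 2 = ‖y - z‖ ^ 2 := by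
    rw [hz, EuclideanSpace.real_norm_sq_eq]
    simp
  rw [hb, norm_gradient_div_norm_sub_sq_rpow hε _ z hyz, hQ,
    mul_div_cancel₀ _ two_ne_zero, div_rpow hε.le hr.le, rpow_sub_one hr.ne' (m : ℝ),
    rpow_natCast]
  generalize ‖y - z‖ ^ 2 = r at hr
  field_simp
  ring

lemma integrableOn_integral_norm_gradient_bubble_sq {m : ℕ} (hm : 2 ≤ m) {ε : ℝ} (hε : 0 < ε)
    (a : EuclideanSpace ℝ (Fin m)) :
    IntegrableOn (fun y => ‖gradient (bubble (m + 1) ε a) y‖ ^ 2)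
        {y : EuclideanSpace ℝ (Fin (m + 1)) | 0 < y (Fin.last m)} ∧
      ∫ y in {y : EuclideanSpace ℝ (Fin (m + 1)) | 0 < y (Fin.last m)},
        ‖gradient (bubble (m + 1) ε a) y‖ ^ 2 =
          (((m : ℝ) - 1) / 2) ^ m * sphereArea (m + 1) := by
  have hm' : (2 : ℝ) ≤ m := by exact_mod_cast hm
  have hk : 0 < (m : ℝ) - 1 := by linarith
  have hc : 0 < ε / ((m : ℝ) - 1) := by positivity
  have hS : MeasurableSet {y : EuclideanSpace ℝ (Fin (m + 1)) | 0 < y (Fin.last m)} :=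
    measurableSet_lt (by fun_prop) (by fun_prop)
  set S := {y : EuclideanSpace ℝ (Fin (m + 1)) | 0 < y (Fin.last m)}
  set g : EuclideanSpace ℝ (Fin (m + 1)) → ℝ := fun y =>
    (((y (Fin.last m) + ε / ((m : ℝ) - 1)) ^ 2 +
      ‖WithLp.toLp 2 (fun i : Fin m => y i.castSucc) - a‖ ^ 2) ^ m)⁻¹ with hg
  have hgm : Measurable g :=
    (measurable_halfSpace_integrand _ a).comp (volume_preserving_last_castSucc m).measurable
  have hg0 : 0 ≤ g := fun y => by
    simp only [hg, Pi.zero_apply]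
    positivity
  have hlin := lintegral_halfSpace hm hc a
  have hint : IntegrableOn g S := by
    rw [IntegrableOn, ← lintegral_ofReal_ne_top_iff_integrable hgm.aestronglyMeasurable
      (ae_of_all _ hg0)]
    exact hlin ▸ ENNReal.ofReal_ne_top
  have hcongr : Set.EqOn (fun y => ((m : ℝ) - 1) ^ 2 * ε ^ ((m : ℝ) - 1) * g y)
      (fun y => ‖gradient (bubble (m + 1) ε a) y‖ ^ 2) S :=
    fun y hy => (norm_gradient_bubble_sq hm hε a hy).symm
  refine ⟨IntegrableOn.congr_fun (hint.const_mul _) hcongr hS, ?_⟩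
  rw [← setIntegral_congr_fun hS hcongr, integral_const_mul,
    integral_eq_lintegral_of_nonneg_ae (ae_of_all _ hg0) hgm.aestronglyMeasurable]
  have hG1 := Gamma_pos_of_pos (show (0 : ℝ) < m by linarith)
  have hG2 := Gamma_pos_of_pos (show (0 : ℝ) < m / 2 by linarith)
  rw [hlin, ENNReal.toReal_ofReal (by positivity), halfSpace_energy_const hm hε]

/-- the Dirichlet energy of the standard bubble over the half-space equals
`K_n^{-2(n-1)} = ((n-2)/2)^{n-1} σ_{n-1}`; in particular it is finite and independent of
`ε` and `a`. -/
theorem bubble_dirichlet_energy (n : ℕ) (hn : 3 ≤ n) (ε : ℝ) (hε : 0 < ε)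
    (a : EuclideanSpace ℝ (Fin (n - 1))) :
    (∫ y in {y : EuclideanSpace ℝ (Fin n) | 0 < lastCoord n y},
        ‖gradient (bubble n ε a) y‖ ^ 2)
      = Kconst n ^ (-(2 : ℝ) * ((n : ℝ) - 1)) ∧
    Kconst n ^ (-(2 : ℝ) * ((n : ℝ) - 1)) = (((n : ℝ) - 2) / 2) ^ (n - 1) * sphereArea n ∧
    IntegrableOn (fun y => ‖gradient (bubble n ε a) y‖ ^ 2)
      {y : EuclideanSpace ℝ (Fin n) | 0 < lastCoord n y} := by
  have hK := Kconst_rpow hn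
  obtain ⟨m, rfl⟩ : ∃ m, n = m + 1 := ⟨n - 1, by omega⟩
  obtain ⟨h1, h2⟩ := integrableOn_integral_norm_gradient_bubble_sq (by omega : 2 ≤ m) hε a
  simp only [lastCoord_succ]
  refine ⟨?_, hK, h1⟩
  rw [hK]
  refine h2.trans ?_
  push_cast
  rw [show (m : ℝ) + 1 - 2 = m - 1 by ring]
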